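/- Let ρ(t) = ‖ξ(t)‖ be the length of the long Jacobi vector of a collision-free solution of the three-body problem defined on [0,∞) with negative total energy H < 0, which is future-unbounded in the sense that lim sup_{t→∞} ρ(t) = +∞, and suppose there is ρ₀′ > 0 such that whenever ρ(t) ≥ ρ₀′ the pair (1,2) realizes the minimal intermass distance. Then there exists a constant c₃ > 0 such that for all sufficiently large ρ₀ there exist ρ* ≥ ρ₀ and times t₁ < t* with ρ(t₁) = ρ*, ρ(t*) = 2ρ*, ρ monotonically increasing on [t₁, t*], and |ρ̇(t)| ≤ c₃ for all t ∈ [t₁, t*]. -/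

import Mathlib

open scoped RealInnerProductSpace
open Set Filter

/-- A function that is strictly concave (with controlled second derivative) where it is large and
is unbounded in the future has doubling arcs of bounded speed. -/
theorem exists_slow_doubling_arc {ρ f g : ℝ → ℝ} {P K : ℝ} (hP : 0 < P) (hK : 0 ≤ K)
    (hc : ContinuousOn ρ (Ici 0))
    (hf : ∀ t ∈ Ici (0 : ℝ), P ≤ ρ t → HasDerivWithinAt ρ (f t) (Ici 0) t)
    (hg : ∀ t ∈ Ici (0 : ℝ), P ≤ ρ t → HasDerivWithinAt f (g t) (Ici 0) t)
    (hneg : ∀ t ∈ Ici (0 : ℝ), P ≤ ρ t → g t < 0)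
    (hlow : ∀ t ∈ Ici (0 : ℝ), P ≤ ρ t → -(K / ρ t ^ 2) ≤ g t)
    (hub : ∀ M : ℝ, ∃ᶠ t in atTop, M ≤ ρ t) :
    ∃ c > (0 : ℝ), ∃ P' : ℝ, ∀ ρ₀ ≥ P', ∃ ρs ≥ ρ₀, ∃ t₁ ts : ℝ,
      0 ≤ t₁ ∧ t₁ < ts ∧ ρ t₁ = ρs ∧ ρ ts = 2 * ρs ∧ StrictMonoOn ρ (Icc t₁ ts) ∧
      ∀ t ∈ Icc t₁ ts, |f t| ≤ c := by
  have anti : ∀ D : Set ℝ, Convex ℝ D → D ⊆ Ici 0 → (∀ t ∈ D, P ≤ ρ t) →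
      StrictAntiOn f D := fun D hD h0 hDP =>
    strictAntiOn_of_hasDerivWithinAt_neg hD
      (fun t ht => (hg t (h0 ht) (hDP t ht)).continuousWithinAt.mono h0)
      (fun t ht => (hg t (h0 (interior_subset ht)) (hDP t (interior_subset ht))).mono
        (interior_subset.trans h0))
      (fun t ht => hneg t (h0 (interior_subset ht)) (hDP t (interior_subset ht)))
  have mono : ∀ D : Set ℝ, Convex ℝ D → D ⊆ Ici 0 → (∀ t ∈ D, P ≤ ρ t) →
      (∀ t ∈ interior D, 0 < f t) → StrictMonoOn ρ D := fun D hD h0 hDP hpos =>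
    strictMonoOn_of_hasDerivWithinAt_pos hD (hc.mono h0)
      (fun t ht => (hf t (h0 (interior_subset ht)) (hDP t (interior_subset ht))).mono
        (interior_subset.trans h0)) hpos
  by_cases hA : ∃ T ≥ (0 : ℝ), ∀ t ≥ T, P ≤ ρ t
  · obtain ⟨T, hT, hTP⟩ := hA
    have hsub : Ici T ⊆ Ici (0 : ℝ) := Ici_subset_Ici.2 hT
    have han := anti (Ici T) (convex_Ici T) hsub hTP
    have hpos : ∀ s ≥ T, 0 < f s := by
      intro s hs
      by_contra! hle
      have hsubs : Ici s ⊆ Ici (0 : ℝ) := Ici_subset_Ici.2 (hT.trans hs)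
      have : AntitoneOn ρ (Ici s) := antitoneOn_of_hasDerivWithinAt_nonpos (convex_Ici s)
        (hc.mono hsubs)
        (fun t ht => (hf t (hsubs (interior_subset ht)) (hTP t (le_trans hs
          (interior_subset ht)))).mono (interior_subset.trans hsubs))
        (fun t ht => ((han.antitoneOn hs (le_trans hs (interior_subset ht) : T ≤ t)
          (interior_subset ht)).trans hle))
      obtain ⟨t, h1, h2⟩ := ((hub (ρ s + 1)).and_eventually (eventually_ge_atTop s)).exists
      have := this (mem_Ici.2 le_rfl) (mem_Ici.2 h2) h2
      linarith
    have hmono := mono (Ici T) (convex_Ici T) hsub hTP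
      (fun t ht => hpos t (interior_subset ht))
    refine ⟨f T, hpos T le_rfl, ρ T, fun ρ₀ hρ₀ => ⟨ρ₀, le_rfl, ?_⟩⟩
    have hρ₀pos : 0 < ρ₀ := lt_of_lt_of_le hP ((hTP T le_rfl).trans hρ₀)
    obtain ⟨t, h1, h2⟩ := ((hub (2 * ρ₀)).and_eventually (eventually_ge_atTop T)).exists
    obtain ⟨t₁, ht₁, e₁⟩ := intermediate_value_Icc h2
      (hc.mono (Icc_subset_Ici_self.trans hsub)) ⟨hρ₀, by linarith⟩
    obtain ⟨ts, hts, es⟩ := intermediate_value_Icc ht₁.2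
      (hc.mono (Icc_subset_Ici_self.trans (Ici_subset_Ici.2 (hT.trans ht₁.1))))
      (show 2 * ρ₀ ∈ Icc (ρ t₁) (ρ t) from ⟨by linarith, h1⟩)
    have hsubI : Icc t₁ ts ⊆ Ici T := Icc_subset_Ici_self.trans (Ici_subset_Ici.2 ht₁.1)
    refine ⟨t₁, ts, hT.trans ht₁.1, lt_of_le_of_ne hts.1 ?_, e₁, es, hmono.mono hsubI, ?_⟩
    · rintro rfl
      linarith
    · intro s hs
      rw [abs_of_pos (hpos s (hsubI hs))]
      exact han.antitoneOn (mem_Ici.2 le_rfl) (hsubI hs) (hsubI hs)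
  · push Not at hA
    refine ⟨√(2 * K / P) + 1, by positivity, P, fun ρ₀ hρ₀ => ⟨ρ₀, le_rfl, ?_⟩⟩
    have hρ₀pos : 0 < ρ₀ := lt_of_lt_of_le hP hρ₀
    obtain ⟨ta, hta, ha⟩ := hA 0 le_rfl
    obtain ⟨tb, hb, htb⟩ := ((hub (2 * ρ₀)).and_eventually (eventually_ge_atTop ta)).exists
    obtain ⟨tc, htc, hcc⟩ := hA tb (hta.le.trans htb)
    have hta : 0 ≤ ta := hta
    have hsub : Icc ta tc ⊆ Ici (0 : ℝ) := Icc_subset_Ici_self.trans (Ici_subset_Ici.2 hta)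
    obtain ⟨tm, htm, hmax⟩ := isCompact_Icc.exists_isMaxOn ⟨tb, htb, htc⟩ (hc.mono hsub)
    have hm : 2 * ρ₀ ≤ ρ tm := hb.trans (hmax ⟨htb, htc⟩)
    have hta' : ta < tm := lt_of_le_of_ne htm.1 (by rintro rfl; linarith)
    have htc' : tm < tc := lt_of_le_of_ne htm.2 (by rintro rfl; linarith)
    have hfm : f tm = 0 := by
      have h1 : IsLocalMax ρ tm := hmax.isLocalMax (Icc_mem_nhds hta' htc')
      exact h1.hasDerivAt_eq_zero
        ((hf tm (hsub htm) (by linarith)).hasDerivAt (Ici_mem_nhds (hta.trans_lt hta')))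
    have hsub' : Icc ta tm ⊆ Ici (0 : ℝ) := Icc_subset_Ici_self.trans (Ici_subset_Ici.2 hta)
    have hclosed : IsClosed (Icc ta tm ∩ ρ ⁻¹' Iic ρ₀) :=
      (hc.mono hsub').preimage_isClosed_of_isClosed isClosed_Icc isClosed_Iic
    have hcomp : IsCompact (Icc ta tm ∩ ρ ⁻¹' Iic ρ₀) :=
      isCompact_Icc.of_isClosed_subset hclosed inter_subset_left
    obtain ⟨t₁, ⟨ht₁, hle₁⟩, hgr⟩ := hcomp.exists_isGreatest
      ⟨ta, ⟨le_rfl, hta'.le⟩, (show ρ ta ≤ ρ₀ by linarith)⟩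
    have hle₁ : ρ t₁ ≤ ρ₀ := hle₁
    have ht₁0 : 0 ≤ t₁ := hta.trans ht₁.1
    have hD0 : Icc t₁ tm ⊆ Ici (0 : ℝ) := Icc_subset_Ici_self.trans (Ici_subset_Ici.2 ht₁0)
    have e₁ : ρ t₁ = ρ₀ := by
      obtain ⟨t, ht, et⟩ := intermediate_value_Icc ht₁.2 (hc.mono hD0)
        (show ρ₀ ∈ Icc (ρ t₁) (ρ tm) from ⟨hle₁, by linarith⟩)
      have : t ≤ t₁ := hgr ⟨⟨ht₁.1.trans ht.1, ht.2⟩, et.le⟩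
      rw [← et, le_antisymm this ht.1]
    have hDρ : ∀ t ∈ Icc t₁ tm, ρ₀ ≤ ρ t := by
      intro t ht
      by_contra! hlt
      have : t ≤ t₁ := hgr ⟨⟨ht₁.1.trans ht.1, ht.2⟩, hlt.le⟩
      rw [le_antisymm this ht.1] at hlt
      linarith
    have hDP : ∀ t ∈ Icc t₁ tm, P ≤ ρ t := fun t ht => hρ₀.trans (hDρ t ht)
    have htm' : tm ∈ Icc t₁ tm := ⟨ht₁.2, le_rfl⟩
    have han := anti (Icc t₁ tm) (convex_Icc _ _) hD0 hDP
    have hnonneg : ∀ t ∈ Icc t₁ tm, 0 ≤ f t := fun t ht =>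
      hfm ▸ han.antitoneOn ht htm' ht.2
    have hmono := mono (Icc t₁ tm) (convex_Icc _ _) hD0 hDP (by
      intro t ht
      rw [interior_Icc] at ht
      exact hfm ▸ han (Ioo_subset_Icc_self ht) htm' ht.2)
    have hE : MonotoneOn (fun t => f t ^ 2 / 2 - K / ρ t) (Icc t₁ tm) := by
      have hd : ∀ t ∈ Icc t₁ tm, HasDerivWithinAt (fun t => f t ^ 2 / 2 - K / ρ t)
          (f t * (g t + K / ρ t ^ 2)) (Ici 0) t := by
        intro t ht
        have hne : ρ t ≠ 0 := (hP.trans_le (hDP t ht)).ne'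
        have := (((hg t (hD0 ht) (hDP t ht)).pow 2).div_const 2).sub
          ((hasDerivWithinAt_const t (Ici 0) K).div (hf t (hD0 ht) (hDP t ht)) hne)
        refine this.congr_deriv ?_
        field_simp
        ring
      refine monotoneOn_of_hasDerivWithinAt_nonneg (convex_Icc _ _)
        (fun t ht => (hd t ht).continuousWithinAt.mono hD0)
        (fun t ht => (hd t (interior_subset ht)).mono (interior_subset.trans hD0)) ?_
      intro t ht
      have ht' := interior_subset ht
      exact mul_nonneg (hnonneg t ht') (by linarith [hlow t (hD0 ht') (hDP t ht')])
    obtain ⟨ts, hts, es⟩ := intermediate_value_Icc ht₁.2 (hc.mono hD0)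
      (show 2 * ρ₀ ∈ Icc (ρ t₁) (ρ tm) from ⟨by linarith, hm⟩)
    have hsubs : Icc t₁ ts ⊆ Icc t₁ tm := Icc_subset_Icc_right hts.2
    refine ⟨t₁, ts, ht₁0, lt_of_le_of_ne hts.1 ?_, e₁, es, hmono.mono hsubs, ?_⟩
    · rintro rfl
      linarith
    · intro t ht
      have ht' := hsubs ht
      have h1 := hE ht' htm' ht'.2
      simp only [hfm] at h1
      have h2 : 0 ≤ K / ρ tm := div_nonneg hK (by linarith)
      have h3 : K / ρ t ≤ K / P := div_le_div_of_nonneg_left hK hP (hDP t ht')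
      have h4 : |f t| ≤ √(2 * K / P) := by
        apply Real.abs_le_sqrt
        rw [mul_div_assoc]
        linarith
      linarith

theorem eq_of_hasDerivWithinAt_Ici_zero {f : ℝ → ℝ}
    (h : ∀ t ∈ Ici (0 : ℝ), HasDerivWithinAt f 0 (Ici 0) t) {t : ℝ} (ht : 0 ≤ t) :
    f t = f 0 :=
  constant_of_has_deriv_right_zero (a := 0) (b := t)
    (fun s hs => (h s hs.1).continuousWithinAt.mono Icc_subset_Ici_self)
    (fun s hs => (h s hs.1).mono (Ici_subset_Ici.2 hs.1)) t ⟨ht, le_rfl⟩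

section
variable {E : Type*} [NormedAddCommGroup E] [InnerProductSpace ℝ E]

theorem HasDerivWithinAt.norm_of_ne_zero {y : ℝ → E} {y' : E} {s : Set ℝ} {t : ℝ}
    (h : HasDerivWithinAt y y' s t) (h0 : y t ≠ 0) :
    HasDerivWithinAt (fun t => ‖y t‖) (⟪y t, y'⟫ / ‖y t‖) s t := by
  have h1 := h.norm_sq.sqrt (by positivity)
  simp only [Real.sqrt_sq (norm_nonneg _)] at h1
  refine h1.congr_deriv ?_
  field_simp

/-- The pairing of the bivectors `x ∧ y` and `a ∧ b`. -/
noncomputable def wedgeInner (x y a b : E) : ℝ := ⟪x, a⟫ * ⟪y, b⟫ - ⟪x, b⟫ * ⟪y, a⟫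

theorem abs_wedgeInner_le (x y a b : E) :
    |wedgeInner x y a b| ≤ 2 * (‖x‖ * ‖y‖) * (‖a‖ * ‖b‖) := by
  unfold wedgeInner
  refine (abs_sub _ _).trans ?_
  rw [abs_mul, abs_mul]
  have h1 := mul_le_mul (abs_real_inner_le_norm x a) (abs_real_inner_le_norm y b)
    (abs_nonneg _) (by positivity)
  have h2 := mul_le_mul (abs_real_inner_le_norm x b) (abs_real_inner_le_norm y a)
    (abs_nonneg _) (by positivity)
  nlinarith

theorem HasDerivWithinAt.wedgeInner {x y : ℝ → E} {z : E} {s : Set ℝ} {t : ℝ}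
    (hx : HasDerivWithinAt x (y t) s t) (hy : HasDerivWithinAt y z s t) (a b : E) :
    HasDerivWithinAt (fun t => wedgeInner (x t) (y t) a b)
      (_root_.wedgeInner (x t) z a b) s t := by
  have k : ∀ {u : ℝ → E} {u' : E}, HasDerivWithinAt u u' s t → ∀ a : E,
      HasDerivWithinAt (fun t => ⟪u t, a⟫) ⟪u', a⟫ s t := fun hu a => by
    simpa using hu.inner ℝ (hasDerivWithinAt_const t s a)
  refine (((k hx a).mul (k hy b)).sub ((k hx b).mul (k hy a))).congr_deriv ?_
  simp only [_root_.wedgeInner]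
  ring

/-- Energy conservation for three bodies. -/
theorem hasDerivWithinAt_energy {m₁ m₂ m₃ : ℝ} {x₁ x₂ x₃ v₁ v₂ v₃ : ℝ → E} {s : Set ℝ} {t : ℝ}
    (h₁₂ : x₁ t ≠ x₂ t) (h₁₃ : x₁ t ≠ x₃ t) (h₂₃ : x₂ t ≠ x₃ t)
    (hx₁ : HasDerivWithinAt x₁ (v₁ t) s t) (hx₂ : HasDerivWithinAt x₂ (v₂ t) s t)
    (hx₃ : HasDerivWithinAt x₃ (v₃ t) s t)
    (hN₁ : HasDerivWithinAt v₁ ((m₂ / ‖x₂ t - x₁ t‖ ^ 3) • (x₂ t - x₁ t) +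
       (m₃ / ‖x₃ t - x₁ t‖ ^ 3) • (x₃ t - x₁ t)) s t)
    (hN₂ : HasDerivWithinAt v₂ ((m₁ / ‖x₁ t - x₂ t‖ ^ 3) • (x₁ t - x₂ t) +
       (m₃ / ‖x₃ t - x₂ t‖ ^ 3) • (x₃ t - x₂ t)) s t)
    (hN₃ : HasDerivWithinAt v₃ ((m₁ / ‖x₁ t - x₃ t‖ ^ 3) • (x₁ t - x₃ t) +
       (m₂ / ‖x₂ t - x₃ t‖ ^ 3) • (x₂ t - x₃ t)) s t) :
    HasDerivWithinAt (fun t =>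
      (1 / 2) * (m₁ * ‖v₁ t‖ ^ 2 + m₂ * ‖v₂ t‖ ^ 2 + m₃ * ‖v₃ t‖ ^ 2) -
        (m₁ * m₂ / ‖x₁ t - x₂ t‖ + m₁ * m₃ / ‖x₁ t - x₃ t‖ +
         m₂ * m₃ / ‖x₂ t - x₃ t‖)) 0 s t := by
  have k : ∀ (c : ℝ) {u w : ℝ → E} {u' w' : E}, HasDerivWithinAt u u' s t →
      HasDerivWithinAt w w' s t → u t ≠ w t → HasDerivWithinAt (fun t => c / ‖u t - w t‖)
        (-(c / ‖u t - w t‖ ^ 3) * ⟪u t - w t, u' - w'⟫) s t := fun c u w u' w' hu hw hne => by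
    have hpos : ‖u t - w t‖ ≠ 0 := norm_ne_zero_iff.2 (sub_ne_zero.2 hne)
    have h := (hu.sub hw).norm_of_ne_zero (sub_ne_zero.2 hne)
    refine ((hasDerivWithinAt_const t s c).div h hpos).congr_deriv ?_
    simp only [Pi.sub_apply]
    field_simp
    ring
  refine ((((((hN₁.norm_sq.const_mul m₁).add (hN₂.norm_sq.const_mul m₂)).add
    (hN₃.norm_sq.const_mul m₃)).const_mul (1 / 2)).sub
    (((k (m₁ * m₂) hx₁ hx₂ h₁₂).add (k (m₁ * m₃) hx₁ hx₃ h₁₃)).add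
      (k (m₂ * m₃) hx₂ hx₃ h₂₃))).congr_deriv ?_)
  rw [norm_sub_rev (x₂ t) (x₁ t), norm_sub_rev (x₃ t) (x₁ t), norm_sub_rev (x₃ t) (x₂ t)]
  simp only [inner_add_right, inner_sub_right, inner_smul_right,
    real_inner_comm (v₁ t), real_inner_comm (v₂ t), real_inner_comm (v₃ t)]
  simp only [div_eq_mul_inv]
  ring

/-- Conservation of the angular momentum in Jacobi coordinates. -/
theorem hasDerivWithinAt_jacobi_angularMomentum {m₁ m₂ m₃ α β γ : ℝ}
    (hM : m₁ + m₂ ≠ 0) (hM' : m₁ + m₂ + m₃ ≠ 0)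
    {r rv ξ ξv : ℝ → E} {s : Set ℝ} {t : ℝ}
    (hr : HasDerivWithinAt r (rv t) s t) (hξ : HasDerivWithinAt ξ (ξv t) s t)
    (hrv : HasDerivWithinAt rv (-((m₁ + m₂) * α) • r t
      + (m₃ * γ) • (ξ t - (m₁ / (m₁ + m₂)) • r t)
      - (m₃ * β) • (ξ t + (m₂ / (m₁ + m₂)) • r t)) s t)
    (hξv : HasDerivWithinAt ξv (-((m₁ + m₂ + m₃) / (m₁ + m₂)) •
      ((m₁ * β) • (ξ t + (m₂ / (m₁ + m₂)) • r t)
        + (m₂ * γ) • (ξ t - (m₁ / (m₁ + m₂)) • r t))) s t) (a b : E) :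
    HasDerivWithinAt (fun t => m₁ * m₂ / (m₁ + m₂) * wedgeInner (r t) (rv t) a b
      + (m₁ + m₂) * m₃ / (m₁ + m₂ + m₃) * wedgeInner (ξ t) (ξv t) a b) 0 s t := by
  refine (((hr.wedgeInner hrv a b).const_mul _).add
    ((hξ.wedgeInner hξv a b).const_mul _)).congr_deriv ?_
  simp only [wedgeInner, inner_add_left, inner_sub_left, real_inner_smul_left]
  field_simp
  ring

/-- Derivative of the radial speed. -/
theorem HasDerivWithinAt.radial_speed {x v : ℝ → E} {a : E} {s : Set ℝ} {t : ℝ}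
    (hx : HasDerivWithinAt x (v t) s t) (hv : HasDerivWithinAt v a s t) (h0 : x t ≠ 0) :
    HasDerivWithinAt (fun t => ⟪x t, v t⟫ / ‖x t‖)
      ((‖v t‖ ^ 2 - (⟪x t, v t⟫ / ‖x t‖) ^ 2 + ⟪x t, a⟫) / ‖x t‖) s t := by
  have hpos : ‖x t‖ ≠ 0 := norm_ne_zero_iff.2 h0
  refine ((hx.inner ℝ hv).div (hx.norm_of_ne_zero h0) hpos).congr_deriv ?_
  rw [real_inner_self_eq_norm_sq]
  field_simp
  ring

/-- The square of the transversal velocity is controlled by the angular momentum. -/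
theorem norm_sq_sub_radial_sq_le {x v : E} (h0 : x ≠ 0) {L : ℝ}
    (hL : ∀ a b : E, |wedgeInner x v a b| ≤ L * (‖a‖ * ‖b‖)) :
    ‖v‖ ^ 2 - (⟪x, v⟫ / ‖x‖) ^ 2 ≤ L ^ 2 / ‖x‖ ^ 2 := by
  have hpos : 0 < ‖x‖ := norm_pos_iff.2 h0
  set w := v - (⟪x, v⟫ / ‖x‖ ^ 2) • x with hw
  have hxw : ⟪x, w⟫ = 0 := by
    rw [hw, inner_sub_right, real_inner_smul_right, real_inner_self_eq_norm_sq]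
    field_simp
    ring
  have hvw : ⟪v, w⟫ = ‖w‖ ^ 2 := by
    have : v = w + (⟪x, v⟫ / ‖x‖ ^ 2) • x := by rw [hw]; abel
    nth_rw 1 [this]
    rw [inner_add_left, real_inner_smul_left, hxw, real_inner_self_eq_norm_sq]
    ring
  have hww : ‖w‖ ^ 2 = ‖v‖ ^ 2 - (⟪x, v⟫ / ‖x‖) ^ 2 := by
    rw [← hvw, hw, inner_sub_right, real_inner_smul_right, real_inner_self_eq_norm_sq,
      real_inner_comm x v]
    ring
  have h := hL x w
  rw [wedgeInner, hxw, hvw, real_inner_self_eq_norm_sq, zero_mul, sub_zero,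
    abs_of_nonneg (by positivity)] at h
  rw [← hww, le_div_iff₀ (by positivity)]
  rcases (norm_nonneg w).eq_or_lt with h1 | h1
  · rw [← h1]; nlinarith [sq_nonneg L]
  · have h2 : ‖x‖ * ‖w‖ ≤ L := by
      refine le_of_mul_le_mul_right ?_ (mul_pos hpos h1)
      linarith
    have := pow_le_pow_left₀ (by positivity) h2 2
    linarith

theorem radial_sq_le_norm_sq (x v : E) : (⟪x, v⟫ / ‖x‖) ^ 2 ≤ ‖v‖ ^ 2 := by
  rcases eq_or_ne x 0 with rfl | h0
  · simp
  have hpos : 0 < ‖x‖ := norm_pos_iff.2 h0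
  rw [← sq_abs, abs_div, abs_norm]
  gcongr
  rw [div_le_iff₀ hpos, mul_comm]
  exact abs_real_inner_le_norm x v

/-- Attraction of a distant point by a point displaced by `d` from the origin. -/
theorem attraction_bounds {x d : E} (hd : 2 * ‖d‖ ≤ ‖x‖) (h0 : x ≠ 0) :
    1 / (16 * ‖x‖) ≤ ⟪x, x + d⟫ / ‖x + d‖ ^ 3 ∧
      ⟪x, x + d⟫ / ‖x + d‖ ^ 3 ≤ 16 / ‖x‖ := by
  have hpos : 0 < ‖x‖ := norm_pos_iff.2 h0
  have hn := norm_nonneg d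
  have h1 : ‖x + d‖ ≤ 2 * ‖x‖ := (norm_add_le x d).trans (by linarith)
  have h2 : ‖x‖ / 2 ≤ ‖x + d‖ := by
    have := norm_sub_norm_le x (-d)
    rw [norm_neg, sub_neg_eq_add] at this
    linarith
  have h3 := abs_le.1 (abs_real_inner_le_norm x d)
  have h4 : ‖x‖ ^ 2 / 2 ≤ ⟪x, x + d⟫ := by
    rw [inner_add_right, real_inner_self_eq_norm_sq]
    nlinarith
  have h5 : ⟪x, x + d⟫ ≤ 2 * ‖x‖ ^ 2 := by
    rw [inner_add_right, real_inner_self_eq_norm_sq]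
    nlinarith
  have hpos' : 0 < ‖x + d‖ := by linarith
  have h6 : 0 ≤ ⟪x, x + d⟫ := le_trans (by positivity) h4
  constructor
  · calc 1 / (16 * ‖x‖) = (‖x‖ ^ 2 / 2) / (2 * ‖x‖) ^ 3 := by field_simp; norm_num
      _ ≤ _ := by gcongr
  · calc _ ≤ (2 * ‖x‖ ^ 2) / (‖x‖ / 2) ^ 3 := by gcongr
      _ = 16 / ‖x‖ := by field_simp; norm_num

/-- Uniform bounds from negative energy when `d₁₂` is the smallest distance. -/
theorem binary_bounds {V : Type*} [NormedAddCommGroup V] {m₁ m₂ m₃ h : ℝ}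
    (hm₁ : 0 < m₁) (hm₂ : 0 < m₂) (hm₃ : 0 < m₃) (hh : 0 < h)
    {d₁₂ d₁₃ d₂₃ : ℝ} {v₁ v₂ v₃ : V} (h₁₂ : 0 < d₁₂) (h₁₃ : d₁₂ ≤ d₁₃) (h₂₃ : d₁₂ ≤ d₂₃)
    (hH : (1 / 2) * (m₁ * ‖v₁‖ ^ 2 + m₂ * ‖v₂‖ ^ 2 + m₃ * ‖v₃‖ ^ 2) -
        (m₁ * m₂ / d₁₂ + m₁ * m₃ / d₁₃ + m₂ * m₃ / d₂₃) = -h) :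
    d₁₂ ≤ (m₁ * m₂ + m₁ * m₃ + m₂ * m₃) / h ∧
      d₁₂ * ‖v₂ - v₁‖ ≤ √((m₁ * m₂ + m₁ * m₃ + m₂ * m₃) / h *
        (4 * (m₁ * m₂ + m₁ * m₃ + m₂ * m₃) * (1 / m₁ + 1 / m₂))) := by
  set S := m₁ * m₂ + m₁ * m₃ + m₂ * m₃ with hS
  have hSpos : 0 < S := by positivity
  have hU : m₁ * m₂ / d₁₂ + m₁ * m₃ / d₁₃ + m₂ * m₃ / d₂₃ ≤ S / d₁₂ := by
    rw [hS, add_div, add_div]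
    gcongr
  have k₁ : 0 ≤ m₁ * ‖v₁‖ ^ 2 := by positivity
  have k₂ : 0 ≤ m₂ * ‖v₂‖ ^ 2 := by positivity
  have k₃ : 0 ≤ m₃ * ‖v₃‖ ^ 2 := by positivity
  have hC : d₁₂ ≤ S / h := by
    rw [le_div_iff₀ hh, mul_comm, ← le_div_iff₀ h₁₂]
    linarith
  refine ⟨hC, Real.le_sqrt_of_sq_le ?_⟩
  have b₁ : d₁₂ * ‖v₁‖ ^ 2 ≤ 2 * S * (1 / m₁) := by
    rw [mul_one_div, le_div_iff₀ hm₁]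
    have : m₁ * ‖v₁‖ ^ 2 ≤ 2 * S / d₁₂ := by rw [mul_div_assoc]; linarith
    rw [le_div_iff₀ h₁₂] at this
    linarith
  have b₂ : d₁₂ * ‖v₂‖ ^ 2 ≤ 2 * S * (1 / m₂) := by
    rw [mul_one_div, le_div_iff₀ hm₂]
    have : m₂ * ‖v₂‖ ^ 2 ≤ 2 * S / d₁₂ := by rw [mul_div_assoc]; linarith
    rw [le_div_iff₀ h₁₂] at this
    linarith
  have b₃ : ‖v₂ - v₁‖ ^ 2 ≤ 2 * ‖v₁‖ ^ 2 + 2 * ‖v₂‖ ^ 2 := by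
    have := pow_le_pow_left₀ (norm_nonneg _) (norm_sub_le v₂ v₁) 2
    nlinarith [sq_nonneg (‖v₂‖ - ‖v₁‖)]
  have b₄ : d₁₂ * ‖v₂ - v₁‖ ^ 2 ≤ 4 * S * (1 / m₁ + 1 / m₂) := by
    have := mul_le_mul_of_nonneg_left b₃ h₁₂.le
    linarith
  calc (d₁₂ * ‖v₂ - v₁‖) ^ 2 = d₁₂ * (d₁₂ * ‖v₂ - v₁‖ ^ 2) := by ring
    _ ≤ _ := mul_le_mul hC b₄ (by positivity) (by positivity)

/-- The radial component of the relative force on the third body. -/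
theorem jacobi_force_bounds {m₁ m₂ m₃ : ℝ} (hm₁ : 0 < m₁) (hm₂ : 0 < m₂) (hm₃ : 0 < m₃)
    {r ξ : E} (hr : 2 * ‖r‖ ≤ ‖ξ‖) (h0 : ξ ≠ 0) :
    ⟪ξ, -((m₁ + m₂ + m₃) / (m₁ + m₂)) •
      ((m₁ * (1 / ‖ξ + (m₂ / (m₁ + m₂)) • r‖ ^ 3)) • (ξ + (m₂ / (m₁ + m₂)) • r)
        + (m₂ * (1 / ‖ξ - (m₁ / (m₁ + m₂)) • r‖ ^ 3)) • (ξ - (m₁ / (m₁ + m₂)) • r))⟫ ∈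
      Icc (-(16 * (m₁ + m₂ + m₃) / ‖ξ‖)) (-((m₁ + m₂ + m₃) / (16 * ‖ξ‖))) := by
  have hpos : 0 < ‖ξ‖ := norm_pos_iff.2 h0
  have small : ∀ c : ℝ, |c| ≤ 1 → 2 * ‖c • r‖ ≤ ‖ξ‖ := fun c hc => by
    rw [norm_smul, Real.norm_eq_abs]
    nlinarith [norm_nonneg r]
  have s₁ := attraction_bounds (small (m₂ / (m₁ + m₂)) (by
    rw [abs_of_pos (by positivity), div_le_one (by positivity)]; linarith)) h0
  have s₂ := attraction_bounds (small (-(m₁ / (m₁ + m₂))) (by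
    rw [abs_neg, abs_of_pos (by positivity), div_le_one (by positivity)]; linarith)) h0
  rw [neg_smul, ← sub_eq_add_neg] at s₂
  rw [real_inner_smul_right, inner_add_right, real_inner_smul_right, real_inner_smul_right]
  set A := ⟪ξ, ξ + (m₂ / (m₁ + m₂)) • r⟫ / ‖ξ + (m₂ / (m₁ + m₂)) • r‖ ^ 3 with hA
  set B := ⟪ξ, ξ - (m₁ / (m₁ + m₂)) • r⟫ / ‖ξ - (m₁ / (m₁ + m₂)) • r‖ ^ 3 with hB
  have e : ∀ m p q : ℝ, m * (1 / p) * q = m * (q / p) := fun m p q => by ring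
  rw [e, e, ← hA, ← hB]
  have hc : 0 < (m₁ + m₂ + m₃) / (m₁ + m₂) := by positivity
  have lo : (m₁ + m₂) * (1 / (16 * ‖ξ‖)) ≤ m₁ * A + m₂ * B := by
    nlinarith [mul_le_mul_of_nonneg_left s₁.1 hm₁.le, mul_le_mul_of_nonneg_left s₂.1 hm₂.le]
  have hi : m₁ * A + m₂ * B ≤ (m₁ + m₂) * (16 / ‖ξ‖) := by
    nlinarith [mul_le_mul_of_nonneg_left s₁.2 hm₁.le, mul_le_mul_of_nonneg_left s₂.2 hm₂.le]
  have lo' := mul_le_mul_of_nonneg_left lo hc.le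
  have hi' := mul_le_mul_of_nonneg_left hi hc.le
  have e₁ : (m₁ + m₂ + m₃) / (m₁ + m₂) * ((m₁ + m₂) * (1 / (16 * ‖ξ‖)))
      = (m₁ + m₂ + m₃) / (16 * ‖ξ‖) := by field_simp
  have e₂ : (m₁ + m₂ + m₃) / (m₁ + m₂) * ((m₁ + m₂) * (16 / ‖ξ‖))
      = 16 * (m₁ + m₂ + m₃) / ‖ξ‖ := by field_simp
  constructor <;> linarith

end

/-- **Proposition (escape/oscillation arcs).** Let `ρ(t) = ‖ξ(t)‖` be the length of the long
Jacobi vector of a collision-free solution of the three-body problem on `[0,∞)` with negative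
total energy, future-unbounded in the sense `lim sup_{t→∞} ρ(t) = +∞`, along which the pair
`(1,2)` realizes the minimal intermass distance whenever `ρ ≥ ρ₀'`.  Then there is a constant
`c₃ > 0` such that for every sufficiently large `ρ₀` there are `ρ* ≥ ρ₀` and times `t₁ < t*`
with `ρ(t₁) = ρ*`, `ρ(t*) = 2ρ*`, `ρ` monotonically increasing on `[t₁, t*]` and
`|ρ̇| ≤ c₃` there (here `ρ̇ = ⟨ξ, ξ̇⟩/ρ`). -/
theorem long_jacobi_slow_doubling_arc
    (m₁ m₂ m₃ : ℝ) (hm₁ : 0 < m₁) (hm₂ : 0 < m₂) (hm₃ : 0 < m₃)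
    (x₁ x₂ x₃ v₁ v₂ v₃ : ℝ → EuclideanSpace ℝ (Fin 3))
    -- the long Jacobi vector, its velocity, and its length
    (ξ ξv : ℝ → EuclideanSpace ℝ (Fin 3)) (ρ : ℝ → ℝ)
    (hξ : ∀ t, ξ t = x₃ t - (m₁ + m₂)⁻¹ • (m₁ • x₁ t + m₂ • x₂ t))
    (hξv : ∀ t, ξv t = v₃ t - (m₁ + m₂)⁻¹ • (m₁ • v₁ t + m₂ • v₂ t))
    (hρ : ∀ t, ρ t = ‖ξ t‖)
    -- collision-free on [0,∞)
    (hsep : ∀ t ∈ Ici (0:ℝ), x₁ t ≠ x₂ t ∧ x₁ t ≠ x₃ t ∧ x₂ t ≠ x₃ t)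
    -- velocities are the derivatives of the positions on [0,∞)
    (hx₁ : ∀ t ∈ Ici (0:ℝ), HasDerivWithinAt x₁ (v₁ t) (Ici 0) t)
    (hx₂ : ∀ t ∈ Ici (0:ℝ), HasDerivWithinAt x₂ (v₂ t) (Ici 0) t)
    (hx₃ : ∀ t ∈ Ici (0:ℝ), HasDerivWithinAt x₃ (v₃ t) (Ici 0) t)
    -- Newton's equations on [0,∞)
    (hN₁ : ∀ t ∈ Ici (0:ℝ), HasDerivWithinAt v₁
      ((m₂ / ‖x₂ t - x₁ t‖ ^ 3) • (x₂ t - x₁ t) +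
       (m₃ / ‖x₃ t - x₁ t‖ ^ 3) • (x₃ t - x₁ t)) (Ici 0) t)
    (hN₂ : ∀ t ∈ Ici (0:ℝ), HasDerivWithinAt v₂
      ((m₁ / ‖x₁ t - x₂ t‖ ^ 3) • (x₁ t - x₂ t) +
       (m₃ / ‖x₃ t - x₂ t‖ ^ 3) • (x₃ t - x₂ t)) (Ici 0) t)
    (hN₃ : ∀ t ∈ Ici (0:ℝ), HasDerivWithinAt v₃
      ((m₁ / ‖x₁ t - x₃ t‖ ^ 3) • (x₁ t - x₃ t) +
       (m₂ / ‖x₂ t - x₃ t‖ ^ 3) • (x₂ t - x₃ t)) (Ici 0) t)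
    -- negative total energy
    (hH : ∀ t ∈ Ici (0:ℝ),
      (1 / 2) * (m₁ * ‖v₁ t‖ ^ 2 + m₂ * ‖v₂ t‖ ^ 2 + m₃ * ‖v₃ t‖ ^ 2) -
        (m₁ * m₂ / ‖x₁ t - x₂ t‖ + m₁ * m₃ / ‖x₁ t - x₃ t‖ +
         m₂ * m₃ / ‖x₂ t - x₃ t‖) < 0)
    -- future-unbounded: lim sup ρ = +∞
    (hub : ∀ M : ℝ, ∃ᶠ t in atTop, M ≤ ρ t)
    -- the pair (1,2) realizes the minimal intermass distance whenever ρ ≥ ρ₀'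
    (ρ₀' : ℝ) (hρ₀' : 0 < ρ₀')
    (hmin : ∀ t ∈ Ici (0:ℝ), ρ₀' ≤ ρ t →
      ‖x₁ t - x₂ t‖ ≤ ‖x₁ t - x₃ t‖ ∧ ‖x₁ t - x₂ t‖ ≤ ‖x₂ t - x₃ t‖) :
    ∃ c₃ > (0:ℝ), ∃ P : ℝ, ∀ ρ₀ ≥ P, ∃ ρstar ≥ ρ₀, ∃ t₁ tstar : ℝ,
      0 ≤ t₁ ∧ t₁ < tstar ∧
      ρ t₁ = ρstar ∧ ρ tstar = 2 * ρstar ∧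
      StrictMonoOn ρ (Icc t₁ tstar) ∧
      ∀ t ∈ Icc t₁ tstar, |⟪ξ t, ξv t⟫| / ρ t ≤ c₃ := by
  have hM : 0 < m₁ + m₂ := by positivity
  have hMt : 0 < m₁ + m₂ + m₃ := by positivity
  obtain rfl : ρ = fun t => ‖ξ t‖ := funext hρ
  set r : ℝ → EuclideanSpace ℝ (Fin 3) := fun t => x₂ t - x₁ t with hr
  set rv : ℝ → EuclideanSpace ℝ (Fin 3) := fun t => v₂ t - v₁ t with hrv
  have hp : ∀ t, x₃ t - x₁ t = ξ t + (m₂ / (m₁ + m₂)) • r t := fun t => by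
    rw [hξ]
    simp only [hr]
    match_scalars <;> field_simp <;> ring
  have hq : ∀ t, x₃ t - x₂ t = ξ t - (m₁ / (m₁ + m₂)) • r t := fun t => by
    rw [hξ]
    simp only [hr]
    match_scalars <;> field_simp <;> ring
  have dr : ∀ t ∈ Ici (0 : ℝ), HasDerivWithinAt r (rv t) (Ici 0) t :=
    fun t ht => (hx₂ t ht).sub (hx₁ t ht)
  have dξ : ∀ t ∈ Ici (0 : ℝ), HasDerivWithinAt ξ (ξv t) (Ici 0) t := fun t ht => by
    rw [funext hξ, hξv]
    exact (hx₃ t ht).sub ((((hx₁ t ht).const_smul m₁).add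
      ((hx₂ t ht).const_smul m₂)).const_smul (m₁ + m₂)⁻¹)
  have drv : ∀ t ∈ Ici (0 : ℝ), HasDerivWithinAt rv
      (-((m₁ + m₂) * (1 / ‖r t‖ ^ 3)) • r t
      + (m₃ * (1 / ‖ξ t - (m₁ / (m₁ + m₂)) • r t‖ ^ 3)) • (ξ t - (m₁ / (m₁ + m₂)) • r t)
      - (m₃ * (1 / ‖ξ t + (m₂ / (m₁ + m₂)) • r t‖ ^ 3)) • (ξ t + (m₂ / (m₁ + m₂)) • r t))
      (Ici 0) t := fun t ht => by
    refine ((hN₂ t ht).sub (hN₁ t ht)).congr_deriv ?_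
    rw [← hp, ← hq, norm_sub_rev (x₁ t) (x₂ t)]
    simp only [hr]
    match_scalars <;> ring
  have dξv : ∀ t ∈ Ici (0 : ℝ), HasDerivWithinAt ξv
      (-((m₁ + m₂ + m₃) / (m₁ + m₂)) •
      ((m₁ * (1 / ‖ξ t + (m₂ / (m₁ + m₂)) • r t‖ ^ 3)) • (ξ t + (m₂ / (m₁ + m₂)) • r t)
        + (m₂ * (1 / ‖ξ t - (m₁ / (m₁ + m₂)) • r t‖ ^ 3)) • (ξ t - (m₁ / (m₁ + m₂)) • r t)))
      (Ici 0) t := fun t ht => by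
    rw [funext hξv]
    refine ((hN₃ t ht).sub ((((hN₁ t ht).const_smul m₁).add
      ((hN₂ t ht).const_smul m₂)).const_smul (m₁ + m₂)⁻¹)).congr_deriv ?_
    rw [← hp, ← hq, norm_sub_rev (x₁ t) (x₂ t), norm_sub_rev (x₁ t) (x₃ t),
      norm_sub_rev (x₂ t) (x₃ t)]
    match_scalars <;> field_simp <;> ring
  obtain ⟨h, hh, hE⟩ : ∃ h > (0 : ℝ), ∀ t ∈ Ici (0 : ℝ),
      (1 / 2) * (m₁ * ‖v₁ t‖ ^ 2 + m₂ * ‖v₂ t‖ ^ 2 + m₃ * ‖v₃ t‖ ^ 2) -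
        (m₁ * m₂ / ‖x₁ t - x₂ t‖ + m₁ * m₃ / ‖x₁ t - x₃ t‖ +
         m₂ * m₃ / ‖x₂ t - x₃ t‖) = -h := by
    refine ⟨_, neg_pos.2 (hH 0 (mem_Ici.2 le_rfl)), fun t ht => ?_⟩
    rw [neg_neg]
    exact eq_of_hasDerivWithinAt_Ici_zero (fun s hs => hasDerivWithinAt_energy (hsep s hs).1
      (hsep s hs).2.1 (hsep s hs).2.2 (hx₁ s hs) (hx₂ s hs) (hx₃ s hs) (hN₁ s hs) (hN₂ s hs)
      (hN₃ s hs)) ht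
  obtain ⟨C, B, hC, hB⟩ : ∃ C B : ℝ, (∀ t ∈ Ici (0 : ℝ), ρ₀' ≤ ‖ξ t‖ → ‖r t‖ ≤ C) ∧
      ∀ t ∈ Ici (0 : ℝ), ρ₀' ≤ ‖ξ t‖ → ‖r t‖ * ‖rv t‖ ≤ B := by
    have key := fun t ht hle => binary_bounds hm₁ hm₂ hm₃ hh
      (norm_pos_iff.2 (sub_ne_zero.2 (hsep t ht).1)) (hmin t ht hle).1 (hmin t ht hle).2 (hE t ht)
    have e : ∀ t, ‖r t‖ = ‖x₁ t - x₂ t‖ := fun t => norm_sub_rev _ _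
    exact ⟨_, _, fun t ht hle => (e t).trans_le (key t ht hle).1,
      fun t ht hle => (congrArg (· * ‖rv t‖) (e t)).trans_le (key t ht hle).2⟩
  obtain ⟨L, hL⟩ : ∃ L : ℝ, ∀ t ∈ Ici (0 : ℝ), ρ₀' ≤ ‖ξ t‖ → ∀ a b,
      |wedgeInner (ξ t) (ξv t) a b| ≤ L * (‖a‖ * ‖b‖) := by
    set μ := m₁ * m₂ / (m₁ + m₂) with hμ
    set ν := (m₁ + m₂) * m₃ / (m₁ + m₂ + m₃) with hν
    have hμ0 : 0 < μ := by positivity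
    have hν0 : 0 < ν := by positivity
    refine ⟨(2 * μ * B + 2 * μ * (‖r 0‖ * ‖rv 0‖) + 2 * ν * (‖ξ 0‖ * ‖ξv 0‖)) / ν,
      fun t ht hle a b => ?_⟩
    have hcons := eq_of_hasDerivWithinAt_Ici_zero
      (fun s hs => hasDerivWithinAt_jacobi_angularMomentum hM.ne' hMt.ne' (dr s hs) (dξ s hs)
        (drv s hs) (dξv s hs) a b) ht
    rw [← hμ, ← hν] at hcons
    have w₁ := abs_wedgeInner_le (r t) (rv t) a b
    have w₂ := abs_wedgeInner_le (r 0) (rv 0) a b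
    have w₃ := abs_wedgeInner_le (ξ 0) (ξv 0) a b
    have hab : 0 ≤ ‖a‖ * ‖b‖ := by positivity
    have w₄ := mul_le_mul_of_nonneg_right (hB t ht hle) hab
    rw [div_mul_eq_mul_div, le_div_iff₀ hν0, mul_comm, ← abs_of_pos hν0, ← abs_mul,
      abs_of_pos hν0]
    have e : ν * wedgeInner (ξ t) (ξv t) a b = μ * wedgeInner (r 0) (rv 0) a b
        + ν * wedgeInner (ξ 0) (ξv 0) a b - μ * wedgeInner (r t) (rv t) a b := by linarith
    have t₁ := abs_sub (μ * wedgeInner (r 0) (rv 0) a b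
        + ν * wedgeInner (ξ 0) (ξv 0) a b) (μ * wedgeInner (r t) (rv t) a b)
    have t₂ := abs_add_le (μ * wedgeInner (r 0) (rv 0) a b) (ν * wedgeInner (ξ 0) (ξv 0) a b)
    rw [e]
    rw [abs_mul, abs_of_pos hμ0] at t₁ t₂
    rw [abs_mul, abs_of_pos hν0] at t₂
    have u₁ := mul_le_mul_of_nonneg_left w₁ hμ0.le
    have u₂ := mul_le_mul_of_nonneg_left w₂ hμ0.le
    have u₃ := mul_le_mul_of_nonneg_left w₃ hν0.le
    have u₄ := mul_le_mul_of_nonneg_left w₄ hμ0.le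
    linarith
  have hC0 : 0 ≤ |C| := abs_nonneg C
  have hL0 : 0 ≤ 16 * L ^ 2 / (m₁ + m₂ + m₃) := by positivity
  set P := ρ₀' + 2 * |C| + 16 * L ^ 2 / (m₁ + m₂ + m₃) + 1 with hP
  have far : ∀ t ∈ Ici (0 : ℝ), P ≤ ‖ξ t‖ → ρ₀' ≤ ‖ξ t‖ ∧ ξ t ≠ 0 ∧ 2 * ‖r t‖ ≤ ‖ξ t‖ ∧
      16 * L ^ 2 < (m₁ + m₂ + m₃) * ‖ξ t‖ := fun t ht hle => by
    have h1 : ρ₀' ≤ ‖ξ t‖ := by linarith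
    refine ⟨h1, norm_pos_iff.1 (by linarith), ?_, ?_⟩
    · linarith [hC t ht h1, le_abs_self C]
    · rw [← div_lt_iff₀' hMt]
      linarith
  obtain ⟨c, hc, P', H⟩ := exists_slow_doubling_arc (ρ := fun t => ‖ξ t‖)
    (f := fun t => ⟪ξ t, ξv t⟫ / ‖ξ t‖) (P := P) (K := 16 * (m₁ + m₂ + m₃))
    (by positivity) (by positivity) (fun t ht => (dξ t ht).continuousWithinAt.norm)
    (fun t ht hle => (dξ t ht).norm_of_ne_zero (far t ht hle).2.1)
    (fun t ht hle => (dξ t ht).radial_speed (dξv t ht) (far t ht hle).2.1)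
    (fun t ht hle => by
      obtain ⟨h1, h2, h3, h4⟩ := far t ht hle
      have hpos : 0 < ‖ξ t‖ := norm_pos_iff.2 h2
      have a₁ := norm_sq_sub_radial_sq_le h2 (hL t ht h1)
      have a₂ := (jacobi_force_bounds hm₁ hm₂ hm₃ h3 h2).2
      have a₃ : L ^ 2 / ‖ξ t‖ ^ 2 < (m₁ + m₂ + m₃) / (16 * ‖ξ t‖) := by
        rw [div_lt_div_iff₀ (by positivity) (by positivity)]
        nlinarith
      exact div_neg_of_neg_of_pos (by linarith) hpos)
    (fun t ht hle => by
      obtain ⟨h1, h2, h3, h4⟩ := far t ht hle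
      have hpos : 0 < ‖ξ t‖ := norm_pos_iff.2 h2
      have a₁ := radial_sq_le_norm_sq (ξ t) (ξv t)
      have a₂ := (jacobi_force_bounds hm₁ hm₂ hm₃ h3 h2).1
      rw [le_div_iff₀ hpos]
      have e : -(16 * (m₁ + m₂ + m₃) / ‖ξ t‖ ^ 2) * ‖ξ t‖
          = -(16 * (m₁ + m₂ + m₃) / ‖ξ t‖) := by field_simp
      linarith)
    hub
  refine ⟨c, hc, P', fun ρ₀ hρ₀ => ?_⟩
  obtain ⟨ρs, hs, t₁, ts, h0, hlt, e₁, e₂, hmono, hbd⟩ := H ρ₀ hρ₀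
  refine ⟨ρs, hs, t₁, ts, h0, hlt, e₁, e₂, hmono, fun t ht => ?_⟩
  have := hbd t ht
  rwa [abs_div, abs_norm] at this
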